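/- For d ∈ {2, 4, 8} and any unit vector φ ∈ C^d ⊗ C^d with largest squared Schmidt coefficient c, the entropic entanglement parameter of the pure state |φ⟩⟨φ| satisfies M(|φ⟩⟨φ|) ≥ −k·c·log₂ c − (1 − k·c)·log₂(1 − k·c), where k = ⌊1/c⌋. -/

import Mathlib

open Matrix Kronecker BigOperators ComplexOrder

noncomputable section

namespace EEP

/-- `-(x * log₂ x)`; note `Real.logb 2 0 = 0`, giving the convention `0·log₂ 0 = 0`. -/
def negMulLog2 (x : ℝ) : ℝ := -(x * Real.logb 2 x)

/-- Shannon entropy (base 2) of a finite family of reals. -/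
def shannon {n : Type*} [Fintype n] (p : n → ℝ) : ℝ := ∑ i, negMulLog2 (p i)

/-- A quantum state: positive semidefinite (hence Hermitian) matrix with trace 1. -/
def IsState {n : Type*} [Fintype n] [DecidableEq n] (ρ : Matrix n n ℂ) : Prop :=
  ρ.PosSemidef ∧ ρ.trace = 1

/-- A rank-one orthogonal projection matrix. -/
def IsRankOneProj {n : Type*} [Fintype n] [DecidableEq n] (P : Matrix n n ℂ) : Prop :=
  P.IsHermitian ∧ P * P = P ∧ P.rank = 1

/-- A von Neumann measurement on `C^d ⊗ C^d`: a family of `d²` rank-one orthogonal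
projections, mutually orthogonal, summing to the identity. -/
def IsMeasurement {d : ℕ} (P : Fin (d^2) → Matrix (Fin d × Fin d) (Fin d × Fin d) ℂ) : Prop :=
  (∀ i, IsRankOneProj (P i)) ∧ (∀ i j, i ≠ j → P i * P j = 0) ∧ (∑ i, P i) = 1

/-- Klein entropy: Shannon entropy of the outcome distribution `pᵢ = Tr(ρ Pᵢ)`. -/
def kleinEntropy {d : ℕ} (ρ : Matrix (Fin d × Fin d) (Fin d × Fin d) ℂ)
    (P : Fin (d^2) → Matrix (Fin d × Fin d) (Fin d × Fin d) ℂ) : ℝ :=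
  shannon (fun i => (ρ * P i).trace.re)

/-- A product state: Kronecker product of two states on `C^d`. -/
def IsProductState {d : ℕ} (δ : Matrix (Fin d × Fin d) (Fin d × Fin d) ℂ) : Prop :=
  ∃ σA σB : Matrix (Fin d) (Fin d) ℂ, IsState σA ∧ IsState σB ∧ δ = σA ⊗ₖ σB

/-- Infimum of the Klein entropy over product states, for a fixed measurement. -/
def infProd {d : ℕ} (P : Fin (d^2) → Matrix (Fin d × Fin d) (Fin d × Fin d) ℂ) : ℝ :=
  sInf {x : ℝ | ∃ δ, IsProductState δ ∧ x = kleinEntropy δ P}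

/-- The entropic entanglement parameter
`M(ρ) = sup_P ( inf_{δ product} H(δ,P) − H(ρ,P) )`. -/
def eep {d : ℕ} (ρ : Matrix (Fin d × Fin d) (Fin d × Fin d) ℂ) : ℝ :=
  sSup {x : ℝ | ∃ P, IsMeasurement P ∧ x = infProd P - kleinEntropy ρ P}

/-- A separable state: finite convex combination of product states. -/
def IsSeparable {d : ℕ} (ρ : Matrix (Fin d × Fin d) (Fin d × Fin d) ℂ) : Prop :=
  ∃ (m : ℕ) (p : Fin m → ℝ) (δ : Fin m → Matrix (Fin d × Fin d) (Fin d × Fin d) ℂ),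
    (∀ i, 0 ≤ p i) ∧ (∑ i, p i) = 1 ∧ (∀ i, IsProductState (δ i)) ∧
    ρ = ∑ i, (p i : ℂ) • δ i

/-- Rank-one projection `|v⟩⟨v|` onto a vector `v`. -/
def projVec {n : Type*} (v : n → ℂ) : Matrix n n ℂ := Matrix.vecMulVec v (star v)

/-- Coefficient matrix `A` of a vector `ψ ∈ C^d ⊗ C^d`, `A i j = ψ (i,j)`. -/
def coeffMat {d : ℕ} (ψ : Fin d × Fin d → ℂ) : Matrix (Fin d) (Fin d) ℂ :=
  Matrix.of fun i j => ψ (i, j)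

/-- The squared Schmidt coefficients of `ψ`: the eigenvalues of `A Aᴴ`
where `A` is the coefficient matrix of `ψ`. -/
def schmidtSq {d : ℕ} (ψ : Fin d × Fin d → ℂ) : Fin d → ℝ :=
  (Matrix.isHermitian_mul_conjTranspose_self (coeffMat ψ)).eigenvalues

/-- Largest squared Schmidt coefficient (square of the largest singular value of `A`). -/
def maxSchmidtSq {d : ℕ} (ψ : Fin d × Fin d → ℂ) : ℝ := ⨆ i, schmidtSq ψ i

/-- A unit vector. -/
def IsUnitVec {n : Type*} [Fintype n] (ψ : n → ℂ) : Prop := (∑ p, Complex.normSq (ψ p)) = 1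

/-- A maximally entangled unit vector: all squared Schmidt coefficients equal `1/d`. -/
def IsMaxEntVec {d : ℕ} (ψ : Fin d × Fin d → ℂ) : Prop :=
  IsUnitVec ψ ∧ ∀ i, schmidtSq ψ i = 1 / d

/-- A von Neumann measurement in a maximally entangled basis. -/
def IsMaxEntMeasurement {d : ℕ}
    (P : Fin (d^2) → Matrix (Fin d × Fin d) (Fin d × Fin d) ℂ) : Prop :=
  IsMeasurement P ∧ ∀ i, ∃ ψ, IsMaxEntVec ψ ∧ P i = projVec ψ

/-- Von Neumann entropy: Shannon entropy of the eigenvalues. -/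
def vnEntropy {n : Type*} [Fintype n] [DecidableEq n] {ρ : Matrix n n ℂ}
    (h : ρ.IsHermitian) : ℝ := shannon h.eigenvalues

/-- Binary Shannon entropy. -/
def binEnt (x : ℝ) : ℝ := negMulLog2 x + negMulLog2 (1 - x)

theorem design2 (s : Fin 2 → ℝ) (hs : ∑ j, s j ^ 2 = 1) :
    ∃ O : Matrix (Fin 2) (Fin 2) ℝ, O * Oᵀ = 1 ∧ (∀ j, O 0 j = s j) ∧
      ∀ i j, ∃ k, |O i j| = |s k| := by
  refine ⟨!![s 0, s 1; -s 1, s 0], ?_, ?_, ?_⟩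
  · simp only [Fin.sum_univ_two] at hs
    ext i j
    fin_cases i <;> fin_cases j <;> simp [Matrix.mul_apply, Fin.sum_univ_two] <;> linarith
  · intro j; fin_cases j <;> rfl
  · intro i j
    fin_cases i <;> fin_cases j <;> simp [Fin.exists_fin_two]

theorem design4 (s : Fin 4 → ℝ) (hs : ∑ j, s j ^ 2 = 1) :
    ∃ O : Matrix (Fin 4) (Fin 4) ℝ, O * Oᵀ = 1 ∧ (∀ j, O 0 j = s j) ∧
      ∀ i j, ∃ k, |O i j| = |s k| := by
  refine ⟨!![s 0, s 1, s 2, s 3; -s 1, s 0, s 3, -s 2; -s 2, -s 3, s 0, s 1;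
    -s 3, s 2, -s 1, s 0], ?_, ?_, ?_⟩
  · simp only [Fin.sum_univ_four] at hs
    ext i j
    fin_cases i <;> fin_cases j <;> simp [Matrix.mul_apply, Fin.sum_univ_four] <;> linarith
  · intro j; fin_cases j <;> rfl
  · intro i j
    fin_cases i <;> fin_cases j <;>
    first
    | (refine ⟨0, ?_⟩; simp; done) | (refine ⟨1, ?_⟩; simp; done) | (refine ⟨2, ?_⟩; simp; done) | (refine ⟨3, ?_⟩; simp; done)

theorem design8 (s : Fin 8 → ℝ) (hs : ∑ j, s j ^ 2 = 1) :
    ∃ O : Matrix (Fin 8) (Fin 8) ℝ, O * Oᵀ = 1 ∧ (∀ j, O 0 j = s j) ∧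
      ∀ i j, ∃ k, |O i j| = |s k| := by
  refine ⟨!![s 0, s 1, s 2, s 3, s 4, s 5, s 6, s 7;
    -s 1, s 0, s 3, -s 2, s 5, -s 4, -s 7, s 6;
    -s 2, -s 3, s 0, s 1, s 6, s 7, -s 4, -s 5;
    -s 3, s 2, -s 1, s 0, s 7, -s 6, s 5, -s 4;
    -s 4, -s 5, -s 6, -s 7, s 0, s 1, s 2, s 3;
    -s 5, s 4, -s 7, s 6, -s 1, s 0, -s 3, s 2;
    -s 6, s 7, s 4, -s 5, -s 2, s 3, s 0, -s 1;
    -s 7, -s 6, s 5, s 4, -s 3, -s 2, s 1, s 0], ?_, ?_, ?_⟩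
  · simp only [Fin.sum_univ_eight] at hs
    ext i j
    fin_cases i <;> fin_cases j <;> simp [Matrix.mul_apply, Fin.sum_univ_eight] <;> linarith
  · intro j; fin_cases j <;> rfl
  · intro i j
    fin_cases i <;> fin_cases j <;>
    first
    | (refine ⟨0, ?_⟩; simp; done) | (refine ⟨1, ?_⟩; simp; done) | (refine ⟨2, ?_⟩; simp; done) | (refine ⟨3, ?_⟩; simp; done)
    | (refine ⟨4, ?_⟩; simp; done) | (refine ⟨5, ?_⟩; simp; done) | (refine ⟨6, ?_⟩; simp; done) | (refine ⟨7, ?_⟩; simp; done)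

theorem svd {d : ℕ} (A : Matrix (Fin d) (Fin d) ℂ) (l : Fin d → ℝ)
    (hl : l = (Matrix.isHermitian_mul_conjTranspose_self A).eigenvalues) :
    ∃ U V : Matrix (Fin d) (Fin d) ℂ, Uᴴ * U = 1 ∧ Vᴴ * V = 1 ∧
      ∀ x y, A x y = ∑ j, U x j * (((√(l j) : ℝ) : ℂ) * V y j) := by
  have hnn : ∀ i, 0 ≤ l i := by
    intro i; rw [hl]; exact (Matrix.posSemidef_self_mul_conjTranspose A).eigenvalues_nonneg i
  have hspec := (Matrix.isHermitian_mul_conjTranspose_self A).conjStarAlgAut_star_eigenvectorUnitary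
  rw [← hl, Unitary.conjStarAlgAut_star_apply] at hspec
  generalize (Matrix.isHermitian_mul_conjTranspose_self A).eigenvectorUnitary = W at hspec
  obtain ⟨U, hU⟩ := W
  have hU1 : Uᴴ * U = 1 := (Matrix.mem_unitaryGroup_iff'.1 hU)
  have hU2 : U * Uᴴ = 1 := (Matrix.mem_unitaryGroup_iff.1 hU)
  set B := Uᴴ * A with hB
  have hBB : B * Bᴴ = diagonal (fun i => ((l i : ℝ) : ℂ)) := by
    rw [hB, conjTranspose_mul, conjTranspose_conjTranspose]
    rw [← Matrix.star_eq_conjTranspose]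
    simp only [Matrix.mul_assoc] at hspec ⊢
    exact hspec
  have hin : ∀ i j, ∑ y, B i y * star (B j y) = if i = j then ((l i : ℝ) : ℂ) else 0 := by
    intro i j
    have := congrFun (congrFun hBB i) j
    simpa [Matrix.mul_apply, Matrix.diagonal_apply] using this
  let f : Fin d → EuclideanSpace ℂ (Fin d) := fun i =>
    WithLp.toLp 2 (fun y => ((√(l i) : ℝ) : ℂ)⁻¹ * B i y)
  have hf : Orthonormal ℂ (Set.domRestrict {i | l i ≠ 0} f) := by
    rw [orthonormal_iff_ite]
    rintro ⟨i, hi⟩ ⟨j, hj⟩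
    have hi : l i ≠ 0 := hi
    change inner ℂ (f i) (f j) = _
    have h1 : inner ℂ (f i) (f j) = ((√(l i) : ℝ) : ℂ)⁻¹ * ((√(l j) : ℝ) : ℂ)⁻¹ *
        ∑ y, B j y * star (B i y) := by
      rw [PiLp.inner_apply, Finset.mul_sum]
      refine Finset.sum_congr rfl fun y _ => ?_
      simp [f]
      ring
    rw [h1, hin]
    by_cases h : i = j
    · subst h
      have : ((l i : ℝ) : ℂ) = ((√(l i) : ℝ) : ℂ) * ((√(l i) : ℝ) : ℂ) := by
        rw [← Complex.ofReal_mul, Real.mul_self_sqrt (hnn i)]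
      have h0 : ((√(l i) : ℝ) : ℂ) ≠ 0 := by
        rw [Complex.ofReal_ne_zero, Real.sqrt_ne_zero (hnn i)]; exact hi
      simp only [if_true, this]
      field_simp
    · simp [h, Ne.symm h]
  obtain ⟨b, hb⟩ := hf.exists_orthonormalBasis_extension_of_card_eq (by simp)
  refine ⟨U, Matrix.of fun y j => b j y, hU1, ?_, ?_⟩
  · ext i j
    have := orthonormal_iff_ite.1 b.orthonormal i j
    rw [PiLp.inner_apply] at this
    simp only [Matrix.mul_apply, Matrix.one_apply, conjTranspose_apply, of_apply]
    rw [← this]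
    refine Finset.sum_congr rfl fun y _ => ?_
    simp
    ring
  · intro x y
    have hA : A = U * B := by rw [hB, ← Matrix.mul_assoc, hU2, Matrix.one_mul]
    conv_lhs => rw [hA, Matrix.mul_apply]
    refine Finset.sum_congr rfl fun j _ => ?_
    congr 1
    simp only [of_apply]
    by_cases h : l j = 0
    · have h2 := hin j j
      simp only [if_true, h, Complex.ofReal_zero] at h2
      have h3 : ∑ y, Complex.normSq (B j y) = 0 := by
        have : ((∑ y, Complex.normSq (B j y) : ℝ) : ℂ) = 0 := by
          rw [← h2]; push_cast
          exact Finset.sum_congr rfl fun y _ => by rw [Complex.star_def, Complex.mul_conj]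
        exact_mod_cast this
      rw [Finset.sum_eq_zero_iff_of_nonneg (fun _ _ => Complex.normSq_nonneg _)] at h3
      rw [Complex.normSq_eq_zero.1 (h3 y (Finset.mem_univ _)), h]; simp
    · have h0 : ((√(l j) : ℝ) : ℂ) ≠ 0 := by
        rw [Complex.ofReal_ne_zero, Real.sqrt_ne_zero (hnn j)]; exact h
      rw [hb j h]
      simp only [f]
      rw [mul_inv_cancel_left₀ h0]

theorem negMulLog2_eq (x : ℝ) : negMulLog2 x = Real.negMulLog x / Real.log 2 := by
  simp [negMulLog2, Real.negMulLog, Real.logb]; ring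

theorem concave2 : ConcaveOn ℝ (Set.Ici 0) negMulLog2 := by
  have h := Real.concaveOn_negMulLog.smul (c := (Real.log 2)⁻¹) (by positivity)
  have e : negMulLog2 = fun x => (Real.log 2)⁻¹ • Real.negMulLog x := by
    funext x
    rw [negMulLog2_eq, div_eq_inv_mul]; rfl
  rw [e]; exact h

theorem negMulLog2_zero : negMulLog2 0 = 0 := by simp [negMulLog2]

/-- chord bound through the origin -/
theorem chord0 {x r : ℝ} (hx : 0 ≤ x) (hxr : x ≤ r) (hr : 0 < r) :
    x / r * negMulLog2 r ≤ negMulLog2 x := by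
  have h := concave2.2 (Set.mem_Ici.2 le_rfl) (Set.mem_Ici.2 hr.le)
    (show 0 ≤ 1 - x / r by rw [sub_nonneg, div_le_one hr]; exact hxr)
    (show 0 ≤ x / r by positivity) (by ring)
  have e : x / r * r = x := by field_simp
  simpa [negMulLog2_zero, e] using h

theorem chord {x r c : ℝ} (hr : 0 < r) (hxr : r ≤ x) (hxc : x ≤ c) (hrc : r < c) :
    negMulLog2 r + (x - r) / (c - r) * (negMulLog2 c - negMulLog2 r) ≤ negMulLog2 x := by
  have hcr : 0 < c - r := sub_pos.2 hrc
  have h := concave2.2 (Set.mem_Ici.2 hr.le) (Set.mem_Ici.2 (hr.trans hrc).le)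
    (show 0 ≤ 1 - (x - r) / (c - r) by rw [sub_nonneg, div_le_one hcr]; linarith)
    (show 0 ≤ (x - r) / (c - r) from div_nonneg (by linarith) hcr.le) (by ring)
  have e : (1 - (x - r) / (c - r)) * r + (x - r) / (c - r) * c = x := by field_simp; ring
  simp only [smul_eq_mul, e] at h
  linarith

theorem entropy_min {ι : Type*} [Fintype ι] (p : ι → ℝ) (c : ℝ) (hc : 0 < c)
    (h0 : ∀ i, 0 ≤ p i) (h1 : ∀ i, p i ≤ c) (hs : ∑ i, p i = 1) :
    -((⌊1/c⌋₊ : ℝ) * c) * Real.logb 2 c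
        - (1 - (⌊1/c⌋₊ : ℝ) * c) * Real.logb 2 (1 - (⌊1/c⌋₊ : ℝ) * c) ≤ shannon p := by
  have hk1 : (⌊1/c⌋₊ : ℝ) * c ≤ 1 := by
    rw [← le_div_iff₀ hc]; exact Nat.floor_le (by positivity)
  have hk2 : 1 < ((⌊1/c⌋₊ : ℝ) + 1) * c := by
    rw [← div_lt_iff₀ hc]; exact Nat.lt_floor_add_one _
  generalize ⌊1/c⌋₊ = k at *
  set r := 1 - (k:ℝ) * c with hr
  have hr0 : 0 ≤ r := by linarith
  have hrc : r < c := by linarith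
  have goal' : (k:ℝ) * negMulLog2 c + negMulLog2 r ≤ shannon p := by
    unfold shannon
    rcases hr0.eq_or_lt with h | h
    · rw [← h, negMulLog2_zero]
      have : ∑ i, p i / c * negMulLog2 c ≤ ∑ i, negMulLog2 (p i) :=
        Finset.sum_le_sum fun i _ => chord0 (h0 i) (h1 i) hc
      rw [← Finset.sum_mul, ← Finset.sum_div, hs] at this
      have e : (k : ℝ) = 1 / c := by rw [eq_div_iff hc.ne']; linarith
      rw [e]; linarith
    · set β := negMulLog2 r / r - (negMulLog2 c - negMulLog2 r) / (c - r) with hβ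
      have hcr : 0 < c - r := sub_pos.2 hrc
      have hβ0 : 0 ≤ β := by
        have := chord0 hr0 hrc.le hc
        rw [hβ, sub_nonneg, div_le_div_iff₀ hcr h]
        have e : r / c * negMulLog2 c = r * negMulLog2 c / c := by ring
        rw [e, div_le_iff₀ hc] at this
        nlinarith
      have hb : ∀ i, p i * (negMulLog2 r / r) - β * max (p i - r) 0 ≤ negMulLog2 (p i) := by
        intro i
        rcases le_total (p i) r with hi | hi
        · rw [max_eq_right (by linarith)]
          have := chord0 (h0 i) hi h
          have e : p i * (negMulLog2 r / r) = p i / r * negMulLog2 r := by ring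
          linarith
        · rw [max_eq_left (by linarith)]
          have := chord h hi (h1 i) hrc
          refine le_trans (le_of_eq ?_) this
          rw [hβ]; field_simp; ring
      have hsum := Finset.sum_le_sum fun i (_ : i ∈ Finset.univ) => hb i
      rw [Finset.sum_sub_distrib, ← Finset.sum_mul, ← Finset.mul_sum, hs] at hsum
      have hm : ∑ i, max (p i - r) 0 ≤ k * (c - r) := by
        classical
        let S := Finset.univ.filter fun i => r < p i
        have e : ∑ i, max (p i - r) 0 = ∑ i ∈ S, (p i - r) := by
          rw [Finset.sum_filter]
          refine Finset.sum_congr rfl fun i _ => ?_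
          split_ifs with hi
          · exact max_eq_left (by linarith)
          · exact max_eq_right (by linarith)
        rw [e]
        rcases le_or_gt S.card k with hS | hS
        · calc ∑ i ∈ S, (p i - r) ≤ ∑ i ∈ S, (c - r) :=
                Finset.sum_le_sum fun i _ => by linarith [h1 i]
            _ = S.card * (c - r) := by rw [Finset.sum_const, nsmul_eq_mul]
            _ ≤ _ := by gcongr
        · have hS' : (k : ℝ) + 1 ≤ S.card := by exact_mod_cast hS
          have : ∑ i ∈ S, p i ≤ 1 := by
            rw [← hs]; exact Finset.sum_le_univ_sum_of_nonneg h0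
          rw [Finset.sum_sub_distrib, Finset.sum_const, nsmul_eq_mul]
          nlinarith
      have h2 := mul_le_mul_of_nonneg_left hm hβ0
      have e : 1 * (negMulLog2 r / r) - β * (k * (c - r)) = k * negMulLog2 c + negMulLog2 r := by
        have : (1:ℝ) = k * c + r := by rw [hr]; ring
        rw [hβ, this]; clear_value r; field_simp; ring
      linarith
  refine le_trans (le_of_eq ?_) goal'
  simp only [negMulLog2]; ring

theorem negMulLog2_nonneg {x : ℝ} (h0 : 0 ≤ x) (h1 : x ≤ 1) : 0 ≤ negMulLog2 x := by
  rw [negMulLog2_eq]; exact div_nonneg (Real.negMulLog_nonneg h0 h1) (Real.log_nonneg (by norm_num))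

theorem negMulLog2_le {x : ℝ} (h0 : 0 ≤ x) : negMulLog2 x ≤ 1 / Real.log 2 := by
  rw [negMulLog2_eq]
  have hl : 0 < Real.log 2 := Real.log_pos (by norm_num)
  apply div_le_div_of_nonneg_right _ hl.le
  rcases h0.eq_or_lt with h | h
  · simp [← h]
  · have := Real.log_le_sub_one_of_pos (inv_pos.2 h)
    rw [Real.log_inv] at this
    have h2 := mul_le_mul_of_nonneg_left this h0
    rw [mul_sub, mul_inv_cancel₀ h.ne'] at h2
    unfold Real.negMulLog
    nlinarith

theorem state_prob {d : ℕ} {ρ : Matrix (Fin d × Fin d) (Fin d × Fin d) ℂ} (hρ : IsState ρ)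
    {P : Fin (d^2) → Matrix (Fin d × Fin d) (Fin d × Fin d) ℂ} (hP : IsMeasurement P) :
    (∀ i, 0 ≤ (ρ * P i).trace.re) ∧ ∑ i, (ρ * P i).trace.re = 1 := by
  constructor
  · intro i
    obtain ⟨hh, hp, -⟩ := hP.1 i
    have e : (ρ * P i).trace = (P i * ρ * (P i)ᴴ).trace := by
      rw [hh.eq, Matrix.mul_assoc, Matrix.trace_mul_comm (P i), Matrix.mul_assoc, hp]
    rw [e]
    exact (Complex.nonneg_iff.1 (hρ.1.mul_mul_conjTranspose_same (P i)).trace_nonneg).1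
  · rw [← Complex.re_sum, ← Matrix.trace_sum, ← Finset.mul_sum, hP.2.2, Matrix.mul_one, hρ.2]
    rfl

theorem klein_nonneg {d : ℕ} {ρ : Matrix (Fin d × Fin d) (Fin d × Fin d) ℂ} (hρ : IsState ρ)
    {P : Fin (d^2) → Matrix (Fin d × Fin d) (Fin d × Fin d) ℂ} (hP : IsMeasurement P) :
    0 ≤ kleinEntropy ρ P := by
  obtain ⟨h0, h1⟩ := state_prob hρ hP
  unfold kleinEntropy shannon
  refine Finset.sum_nonneg fun i _ => negMulLog2_nonneg (h0 i) ?_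
  rw [← h1]
  exact Finset.single_le_sum (f := fun i => (ρ * P i).trace.re) (fun i _ => h0 i)
    (Finset.mem_univ i)

theorem klein_le {d : ℕ} {ρ : Matrix (Fin d × Fin d) (Fin d × Fin d) ℂ} (hρ : IsState ρ)
    {P : Fin (d^2) → Matrix (Fin d × Fin d) (Fin d × Fin d) ℂ} (hP : IsMeasurement P) :
    kleinEntropy ρ P ≤ ∑ _i : Fin (d^2), 1 / Real.log 2 := by
  unfold kleinEntropy shannon
  exact Finset.sum_le_sum fun i _ => negMulLog2_le ((state_prob hρ hP).1 i)

theorem prod_state {d : ℕ} {δ : Matrix (Fin d × Fin d) (Fin d × Fin d) ℂ}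
    (h : IsProductState δ) : IsState δ := by
  obtain ⟨a, b, ha, hb, rfl⟩ := h
  exact ⟨ha.1.kronecker hb.1, by rw [Matrix.trace_kronecker, ha.2, hb.2, one_mul]⟩

theorem projVec_state {n : Type*} [Fintype n] [DecidableEq n] {φ : n → ℂ} (h : IsUnitVec φ) :
    IsState (projVec φ) := by
  refine ⟨Matrix.posSemidef_vecMulVec_self_star φ, ?_⟩
  unfold IsUnitVec at h
  simp only [projVec, Matrix.trace, Matrix.diag_apply, vecMulVec_apply, Pi.star_apply,
    Complex.star_def, Complex.mul_conj]
  exact_mod_cast h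

theorem exists_prod (d : ℕ) (hd : 0 < d) :
    ∃ δ : Matrix (Fin d × Fin d) (Fin d × Fin d) ℂ, IsProductState δ := by
  have : IsState (projVec (Pi.single (⟨0, hd⟩ : Fin d) (1:ℂ))) := by
    apply projVec_state
    unfold IsUnitVec
    rw [Finset.sum_eq_single ⟨0, hd⟩] <;> simp +contextual
  exact ⟨_, _, _, this, this, rfl⟩

theorem eep_ge {d : ℕ} (hd : 0 < d) {ρ : Matrix (Fin d × Fin d) (Fin d × Fin d) ℂ}
    (hρ : IsState ρ) {P : Fin (d^2) → Matrix (Fin d × Fin d) (Fin d × Fin d) ℂ}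
    (hP : IsMeasurement P) : infProd P - kleinEntropy ρ P ≤ eep ρ := by
  refine le_csSup ⟨∑ _i : Fin (d^2), 1 / Real.log 2, ?_⟩ ⟨P, hP, rfl⟩
  rintro x ⟨Q, hQ, rfl⟩
  obtain ⟨δ, hδ⟩ := exists_prod d hd
  have h1 : infProd Q ≤ kleinEntropy δ Q := by
    refine csInf_le ⟨0, ?_⟩ ⟨δ, hδ, rfl⟩
    rintro y ⟨δ', h', rfl⟩
    exact klein_nonneg (prod_state h') hQ
  have h2 := klein_le (prod_state hδ) hQ
  have h3 := klein_nonneg hρ hQ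
  linarith

theorem projVec_mulVec {n : Type*} [Fintype n] (W : Matrix n n ℂ) (e : n → ℂ) :
    projVec (W *ᵥ e) = W * projVec e * Wᴴ := by
  rw [projVec, projVec, Matrix.star_mulVec, Matrix.mul_vecMulVec, Matrix.vecMulVec_mul]

theorem meas_of_unitary {d : ℕ} (M : Matrix (Fin d × Fin d) (Fin d × Fin d) ℂ) (hM : Mᴴ * M = 1)
    (e : Fin (d^2) ≃ Fin d × Fin d) : IsMeasurement (fun i => projVec (M.col (e i))) := by
  have hdot : ∀ p q, star (M.col p) ⬝ᵥ M.col q = if p = q then 1 else 0 := by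
    intro p q
    have := congrFun (congrFun hM p) q
    rw [Matrix.one_apply] at this
    rw [← this]
    rfl
  have hmul : ∀ p q, projVec (M.col p) * projVec (M.col q) =
      if p = q then projVec (M.col p) else 0 := by
    intro p q
    rw [projVec, projVec, Matrix.vecMulVec_mul_vecMulVec, hdot]
    split_ifs with h
    · subst h; simp
    · simp
  refine ⟨fun i => ⟨?_, ?_, ?_⟩, ?_, ?_⟩
  · exact (Matrix.posSemidef_vecMulVec_self_star _).isHermitian
  · rw [hmul, if_pos rfl]
  · apply le_antisymm
    · exact Matrix.rank_vecMulVec_le _ _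
    · rw [Nat.one_le_iff_ne_zero]
      intro h
      have h : projVec (M.col (e i)) = 0 := by
        rw [Matrix.rank, Submodule.finrank_eq_zero, LinearMap.range_eq_bot] at h
        ext x y
        have := congrFun (LinearMap.congr_fun h (Pi.single y 1)) x
        simpa using this
      have h2 : (projVec (M.col (e i))).trace = 1 := by
        rw [projVec, Matrix.trace_vecMulVec, dotProduct_comm, hdot, if_pos rfl]
      rw [h] at h2
      simp at h2
  · intro i j hij
    rw [hmul, if_neg (fun h => hij (e.injective h))]
  · rw [e.sum_comp (fun p => projVec (M.col p))]
    rw [← mul_eq_one_comm.1 hM]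
    ext x y
    simp [Matrix.sum_apply, projVec, vecMulVec_apply, Matrix.mul_apply]

theorem state_conj {n : Type*} [Fintype n] [DecidableEq n] {σ U : Matrix n n ℂ}
    (h : IsState σ) (hU : Uᴴ * U = 1) : IsState (Uᴴ * σ * U) := by
  refine ⟨h.1.conjTranspose_mul_mul_same U, ?_⟩
  rw [Matrix.trace_mul_comm, ← Matrix.mul_assoc, mul_eq_one_comm.1 hU, Matrix.one_mul, h.2]

/-- purity is at most 1 -/
theorem purity {n : Type*} [Fintype n] [DecidableEq n] {σ : Matrix n n ℂ}
    (h : IsState σ) : ∑ i, ∑ j, ‖σ i j‖ ^ 2 ≤ 1 := by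
  have hm : ∀ i j, ‖σ i j‖ ^ 2 ≤ (σ i i).re * (σ j j).re := by
    intro i j
    have h2 := (h.1.submatrix ![i, j]).det_nonneg
    rw [Matrix.det_fin_two] at h2
    simp only [submatrix_apply, Matrix.cons_val_zero, Matrix.cons_val_one] at h2
    have hji : σ j i = star (σ i j) := (h.1.isHermitian.apply j i).symm
    rw [hji, Complex.star_def, Complex.mul_conj] at h2
    have hii : (σ i i).im = 0 := ((Complex.nonneg_iff.1 (h.1.diag_nonneg (i := i))).2).symm
    have h3 := (Complex.nonneg_iff.1 h2).1
    rw [Complex.sub_re, Complex.mul_re, hii, Complex.ofReal_re, Complex.normSq_eq_norm_sq] at h3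
    linarith
  have ht : ∑ i, (σ i i).re = 1 := by
    rw [← Complex.re_sum]
    have := h.2
    rw [Matrix.trace] at this
    simp only [Matrix.diag_apply] at this
    rw [this]; rfl
  calc ∑ i, ∑ j, ‖σ i j‖ ^ 2 ≤ ∑ i, ∑ j, (σ i i).re * (σ j j).re :=
        Finset.sum_le_sum fun i _ => Finset.sum_le_sum fun j _ => hm i j
    _ = 1 := by rw [← Finset.sum_mul_sum, ht, one_mul]

theorem overlap {n : Type*} [Fintype n] [DecidableEq n] {α β : Matrix n n ℂ}
    (hα : IsState α) (hβ : IsState β) (c : ℝ) (hc : 0 ≤ c) (o : n → ℝ) (ho : ∀ i, |o i| ≤ √c)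
    (s : n ≃ n) :
    ((α ⊗ₖ β) * projVec (fun q : n × n => if q.2 = s q.1 then ((o q.1 : ℝ) : ℂ) else 0)).trace.re
      ≤ c := by
  have e : ((α ⊗ₖ β) * projVec (fun q : n × n => if q.2 = s q.1 then ((o q.1 : ℝ) : ℂ) else 0)).trace
      = ∑ i, ∑ j, α i j * β (s i) (s j) * (o j * o i) := by
    simp only [Matrix.trace, Matrix.diag_apply, Matrix.mul_apply, projVec, vecMulVec_apply,
      Fintype.sum_prod_type, kroneckerMap_apply, Pi.star_apply]
    refine Finset.sum_congr rfl fun i _ => ?_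
    rw [Finset.sum_eq_single (s i) (fun b _ hb => by simp [hb]) (by simp)]
    refine Finset.sum_congr rfl fun j _ => ?_
    rw [Finset.sum_eq_single (s j) (fun b _ hb => by simp [hb]) (by simp)]
    simp
  rw [e]
  have h2 : ∑ i, ∑ j, ‖β (s i) (s j)‖ ^ 2 ≤ 1 := by
    rw [s.sum_comp (fun i => ∑ j, ‖β i (s j)‖ ^ 2)]
    refine le_trans (le_of_eq ?_) (purity hβ)
    exact Finset.sum_congr rfl fun i _ => s.sum_comp (fun j => ‖β i j‖ ^ 2)
  have h1 := purity hα
  have hb : ∀ i j, (α i j * β (s i) (s j) * (o j * o i)).re ≤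
      c / 2 * ‖α i j‖ ^ 2 + c / 2 * ‖β (s i) (s j)‖ ^ 2 := by
    intro i j
    refine (Complex.re_le_norm _).trans ?_
    rw [norm_mul, norm_mul, norm_mul, Complex.norm_real, Complex.norm_real, Real.norm_eq_abs,
      Real.norm_eq_abs]
    have hoo : |o j| * |o i| ≤ c := by
      calc |o j| * |o i| ≤ √c * √c := mul_le_mul (ho j) (ho i) (abs_nonneg _) (Real.sqrt_nonneg _)
        _ = c := Real.mul_self_sqrt hc
    have := mul_le_mul_of_nonneg_left hoo
      (mul_nonneg (norm_nonneg (α i j)) (norm_nonneg (β (s i) (s j))))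
    nlinarith [mul_nonneg hc (sq_nonneg (‖α i j‖ - ‖β (s i) (s j)‖))]
  rw [Complex.re_sum]
  simp only [Complex.re_sum]
  calc _ ≤ ∑ i, ∑ j, (c / 2 * ‖α i j‖ ^ 2 + c / 2 * ‖β (s i) (s j)‖ ^ 2) :=
        Finset.sum_le_sum fun i _ => Finset.sum_le_sum fun j _ => hb i j
    _ = c / 2 * ∑ i, ∑ j, ‖α i j‖ ^ 2 + c / 2 * ∑ i, ∑ j, ‖β (s i) (s j)‖ ^ 2 := by
        simp only [Finset.sum_add_distrib, Finset.mul_sum]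
    _ ≤ c := by nlinarith

theorem key {d : ℕ} [NeZero d]
    (hdes : ∀ s : Fin d → ℝ, ∑ j, s j ^ 2 = 1 →
      ∃ O : Matrix (Fin d) (Fin d) ℝ, O * Oᵀ = 1 ∧ (∀ j, O 0 j = s j) ∧
      ∀ i j, ∃ k, |O i j| = |s k|)
    (φ : Fin d × Fin d → ℂ) (hφ : IsUnitVec φ) (c : ℝ) (hc : c = maxSchmidtSq φ) :
    -((⌊1/c⌋₊ : ℝ) * c) * Real.logb 2 c
        - (1 - (⌊1/c⌋₊ : ℝ) * c) * Real.logb 2 (1 - (⌊1/c⌋₊ : ℝ) * c)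
      ≤ eep (projVec φ) := by
  have hnn : ∀ i, 0 ≤ schmidtSq φ i := fun i =>
    (Matrix.posSemidef_self_mul_conjTranspose (coeffMat φ)).eigenvalues_nonneg i
  have hle : ∀ i, schmidtSq φ i ≤ c := fun i => by
    rw [hc]; exact le_ciSup (Set.finite_range _).bddAbove i
  have hsum : ∑ i, schmidtSq φ i = 1 := by
    have h := (Matrix.isHermitian_mul_conjTranspose_self (coeffMat φ)).trace_eq_sum_eigenvalues
    have h2 : (coeffMat φ * (coeffMat φ)ᴴ).trace = 1 := by
      simp only [Matrix.trace, Matrix.diag_apply, Matrix.mul_apply, conjTranspose_apply,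
        Complex.star_def, Complex.mul_conj, coeffMat, of_apply]
      unfold IsUnitVec at hφ
      rw [Fintype.sum_prod_type] at hφ
      exact_mod_cast hφ
    rw [h2] at h
    have h3 : ((∑ i, schmidtSq φ i : ℝ) : ℂ) = 1 := by
      rw [h]; push_cast; rfl
    exact_mod_cast h3
  have hc0 : 0 < c := by
    by_contra hneg
    have : ∑ i, schmidtSq φ i ≤ 0 := Finset.sum_nonpos fun i _ => by linarith [hle i]
    linarith
  obtain ⟨U, V, hU, hV, hA⟩ := svd (coeffMat φ) (schmidtSq φ) rfl
  obtain ⟨O, hO, hO0, hOk⟩ := hdes (fun j => √(schmidtSq φ j)) (by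
    rw [← hsum]; exact Finset.sum_congr rfl fun j _ => Real.sq_sqrt (hnn j))
  have hOle : ∀ i j, |O i j| ≤ √c := by
    intro i j
    obtain ⟨k, hk⟩ := hOk i j
    rw [hk, abs_of_nonneg (Real.sqrt_nonneg _)]
    exact Real.sqrt_le_sqrt (hle k)
  let E : Matrix (Fin d × Fin d) (Fin d × Fin d) ℂ := Matrix.of fun q p =>
    if q.2 = Equiv.addRight p.1 q.1 then ((O p.2 q.1 : ℝ) : ℂ) else 0
  have hE : Eᴴ * E = 1 := by
    ext ⟨a, b⟩ ⟨a', b'⟩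
    have h := congrFun (congrFun hO b) b'
    simp only [Matrix.mul_apply, transpose_apply] at h
    simp only [Matrix.mul_apply, Fintype.sum_prod_type, conjTranspose_apply, E, of_apply]
    have h1 : ∀ j : Fin d, ∑ l, star (if l = Equiv.addRight a j then ((O b j : ℝ) : ℂ) else 0) *
        (if l = Equiv.addRight a' j then ((O b' j : ℝ) : ℂ) else 0) =
        if a = a' then ((O b j * O b' j : ℝ) : ℂ) else 0 := by
      intro j
      rw [Finset.sum_eq_single (Equiv.addRight a j) (fun l _ hl => by rw [if_neg hl]; simp) (by simp)]
      by_cases haa : a = a' <;> simp [haa]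
    rw [Finset.sum_congr rfl fun j _ => h1 j]
    by_cases haa : a = a'
    · subst haa
      simp only [if_true]
      rw [← Complex.ofReal_sum, h]
      by_cases hbb : b = b' <;> simp [Matrix.one_apply, hbb]
    · simp [haa, Matrix.one_apply]
  let W := U ⊗ₖ V
  have hW : Wᴴ * W = 1 := by
    simp only [W]
    rw [Matrix.conjTranspose_kronecker, ← Matrix.mul_kronecker_mul, hU, hV, Matrix.one_kronecker_one]
  have hM : (W * E)ᴴ * (W * E) = 1 := by
    rw [Matrix.conjTranspose_mul, Matrix.mul_assoc, ← Matrix.mul_assoc Wᴴ, hW, Matrix.one_mul, hE]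
  have hcol : ∀ p, (W * E).col p = W *ᵥ E.col p := fun p => rfl
  have ecard : Fintype.card (Fin (d^2)) = Fintype.card (Fin d × Fin d) := by simp [sq]
  let e : Fin (d^2) ≃ Fin d × Fin d := Fintype.equivOfCardEq ecard
  have hP := meas_of_unitary (W * E) hM e
  set P : Fin (d^2) → Matrix (Fin d × Fin d) (Fin d × Fin d) ℂ :=
    fun i => projVec ((W * E).col (e i)) with hPdef
  have hφcol : (W * E).col (0, 0) = φ := by
    rw [hcol]
    ext ⟨x, y⟩
    have := hA x y
    simp only [coeffMat, of_apply] at this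
    rw [this]
    simp only [mulVec, dotProduct, Fintype.sum_prod_type, Matrix.col_apply, E, of_apply, W,
      kroneckerMap_apply]
    refine Finset.sum_congr rfl fun j _ => ?_
    rw [Finset.sum_eq_single j (fun l _ hl => by simp [hl]) (by simp)]
    simp [hO0]
    ring
  have hPφ : P (e.symm (0, 0)) = projVec φ := by
    simp only [hPdef, Equiv.apply_symm_apply, hφcol]
  have hst := projVec_state hφ
  have hk : kleinEntropy (projVec φ) P = 0 := by
    unfold kleinEntropy shannon
    refine Finset.sum_eq_zero fun i _ => ?_
    by_cases hi : i = e.symm (0, 0)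
    · have : projVec φ * P i = projVec φ := by
        rw [hi, hPφ, ← hPφ]; exact (hP.1 _).2.1
      simp only [this, hst.2]
      simp [negMulLog2]
    · have : projVec φ * P i = 0 := by
        rw [← hPφ]; exact hP.2.1 _ _ (Ne.symm hi)
      simp only [this]
      simp [negMulLog2]
  have hge := eep_ge (Nat.pos_of_neZero d) hst hP
  rw [hk, sub_zero] at hge
  refine le_trans ?_ hge
  apply le_csInf
  · obtain ⟨δ, hδ⟩ := exists_prod d (Nat.pos_of_neZero d)
    exact ⟨_, δ, hδ, rfl⟩
  · rintro x ⟨δ, hδ, rfl⟩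
    obtain ⟨h0, h1⟩ := state_prob (prod_state hδ) hP
    refine entropy_min _ c hc0 h0 ?_ h1
    intro i
    obtain ⟨σA, σB, hσA, hσB, rfl⟩ := hδ
    have e1 : ((σA ⊗ₖ σB) * P i).trace =
        (((Uᴴ * σA * U) ⊗ₖ (Vᴴ * σB * V)) * projVec (E.col (e i))).trace := by
      simp only [hPdef]
      rw [hcol, projVec_mulVec, Matrix.mul_kronecker_mul, Matrix.mul_kronecker_mul,
        ← Matrix.conjTranspose_kronecker]
      change ((σA ⊗ₖ σB) * (W * projVec (E.col (e i)) * Wᴴ)).trace =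
        (Wᴴ * (σA ⊗ₖ σB) * W * projVec (E.col (e i))).trace
      rw [← Matrix.mul_assoc, Matrix.trace_mul_comm]
      simp only [Matrix.mul_assoc]
    rw [e1]
    exact overlap (state_conj hσA hU) (state_conj hσB hV) c hc0.le (fun j => O (e i).2 j)
      (hOle _) (Equiv.addRight (e i).1)

/-- For d ∈ {2,4,8} and a unit vector φ with largest squared Schmidt coefficient c,
M(|φ⟩⟨φ|) ≥ −k c log₂ c − (1 − k c) log₂(1 − k c), k = ⌊1/c⌋. -/
theorem stmt13 {d : ℕ} (hd : d = 2 ∨ d = 4 ∨ d = 8) (φ : Fin d × Fin d → ℂ)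
    (hφ : IsUnitVec φ) (c : ℝ) (hc : c = maxSchmidtSq φ) :
    -((⌊1/c⌋₊ : ℝ) * c) * Real.logb 2 c
        - (1 - (⌊1/c⌋₊ : ℝ) * c) * Real.logb 2 (1 - (⌊1/c⌋₊ : ℝ) * c)
      ≤ eep (projVec φ) := by
  rcases hd with rfl | rfl | rfl
  · exact key design2 φ hφ c hc
  · exact key design4 φ hφ c hc
  · exact key design8 φ hφ c hc

end EEP
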